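/- Suppose E ∈ C¹(X,ℝ) and let {v_j}_{j=0}^k (k ≥ 0) be a subset of V_0. If E has a peak selection p with respect to L, written p(v_j) = t_j v_j + w_j^L with t_j ≥ 0 and w_j^L ∈ L for j = 0,…,k, satisfying (i) p is continuous on V_0, (ii) t_k > 0, and (iii) g_k = ∇E(p(v_k)) ≠ 0, then for any positive integer M and any σ ∈ (0,1), there exists α_k^A > 0 such that E(p(v_k(α))) ≤ max_{1≤j≤min{M,k+1}} E(p(v_{k+1−j})) − σ α t_k ‖g_k‖² for all α ∈ (0, α_k^A). -/

import Mathlib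

open Filter Topology Set
open scoped RealInnerProductSpace ENNReal

noncomputable section

/-- The half subspace `[L, v] = {t • v + w : t ≥ 0, w ∈ L}`. -/
def halfspaceCone {X : Type*} [NormedAddCommGroup X] [InnerProductSpace ℝ X]
    (L : Submodule ℝ X) (v : X) : Set X :=
  {y | ∃ t : ℝ, 0 ≤ t ∧ ∃ w ∈ (L : Set X), y = t • v + w}

/-- The normalized gradient-step map `v(α) = (v - α g)/‖v - α g‖`. -/
def stepv {X : Type*} [NormedAddCommGroup X] [InnerProductSpace ℝ X] (v g : X) (α : ℝ) : X :=
  ‖v - α • g‖⁻¹ • (v - α • g)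

/-- The set `V₀ = {v = v⊥ + τ v₀^L ∈ S : v⊥ ∈ L⊥, 0 ≤ τ ≤ 1}`. -/
def V0 {X : Type*} [NormedAddCommGroup X] [InnerProductSpace ℝ X]
    (L : Submodule ℝ X) (v0L : X) : Set X :=
  {v | ‖v‖ = 1 ∧ ∃ w ∈ (Lᗮ : Set X), ∃ τ : ℝ, 0 ≤ τ ∧ τ ≤ 1 ∧ v = w + τ • v0L}

/-- At a local maximizer over `[L, v]` with positive `v`-coefficient, the gradient is orthogonal
to both `v` and `L`. -/
theorem inner_gradient_eq_zero_of_isLocalMaxOn_halfspaceCone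
    {X : Type*} [NormedAddCommGroup X] [InnerProductSpace ℝ X] [CompleteSpace X]
    {E : X → ℝ} {L : Submodule ℝ X} {v w x : X} {t : ℝ} (hE : DifferentiableAt ℝ E x)
    (hx : x = t • v + w) (ht : 0 < t) (hw : w ∈ L)
    (hmax : IsLocalMaxOn E (halfspaceCone L v) x) (c : ℝ) {l : X} (hl : l ∈ L) :
    inner ℝ (gradient E x) (c • v + l) = 0 := by
  set d := c • v + l with hd
  have hline : HasDerivAt (fun r : ℝ => x + r • d) d 0 := by
    simpa using ((hasDerivAt_id (0 : ℝ)).smul_const d).const_add x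
  have hderiv : HasDerivAt (fun r : ℝ => E (x + r • d)) (fderiv ℝ E x d) 0 := by
    refine HasFDerivAt.comp_hasDerivAt (l := E) (f := fun r : ℝ => x + r • d) 0 ?_ hline
    simpa using hE.hasFDerivAt
  have hcone : ∀ᶠ r : ℝ in 𝓝 0, x + r • d ∈ halfspaceCone L v := by
    have hcont : Tendsto (fun r : ℝ => t + r * c) (𝓝 0) (𝓝 t) := by
      have : Continuous fun r : ℝ => t + r * c := by fun_prop
      simpa using this.tendsto 0
    filter_upwards [hcont.eventually_const_lt ht] with r hr
    refine ⟨t + r * c, hr.le, w + r • l, L.add_mem hw (L.smul_mem r hl), ?_⟩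
    rw [hx, hd]
    module
  have hlim : Tendsto (fun r : ℝ => x + r • d) (𝓝 0) (𝓝[halfspaceCone L v] x) :=
    tendsto_nhdsWithin_iff.2 ⟨by simpa using hline.continuousAt.tendsto, hcone⟩
  have hloc : IsLocalMax (fun r : ℝ => E (x + r • d)) 0 := by
    filter_upwards [hlim.eventually hmax] with r hr
    simpa using hr
  rw [inner_gradient_left]
  exact hloc.hasDerivAt_eq_zero hderiv

theorem norm_sub_smul_ge_one_of_inner_eq_zero
    {X : Type*} [NormedAddCommGroup X] [InnerProductSpace ℝ X]
    {v g : X} (hv : ‖v‖ = 1) (hvg : inner ℝ g v = 0) (a : ℝ) : 1 ≤ ‖v - a • g‖ := by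
  have h : ‖v - a • g‖ ^ 2 = 1 + ‖a • g‖ ^ 2 := by
    rw [norm_sub_sq_real, hv, real_inner_smul_right, real_inner_comm, hvg]
    ring
  nlinarith [norm_nonneg (v - a • g), sq_nonneg ‖a • g‖]

theorem stepv_mem_V0 {X : Type*} [NormedAddCommGroup X] [InnerProductSpace ℝ X]
    {L : Submodule ℝ X} {v0L v g : X} (hv : v ∈ V0 L v0L) (hg : g ∈ Lᗮ)
    (hvg : inner ℝ g v = 0) (a : ℝ) : stepv v g a ∈ V0 L v0L := by
  obtain ⟨hv1, w, hw, τ, hτ0, hτ1, hvw⟩ := hv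
  have hN := norm_sub_smul_ge_one_of_inner_eq_zero hv1 hvg a
  have hN0 : ‖v - a • g‖ ≠ 0 := by positivity
  refine ⟨?_, ‖v - a • g‖⁻¹ • (w - a • g),
    Lᗮ.smul_mem _ (Lᗮ.sub_mem hw (Lᗮ.smul_mem a hg)), ‖v - a • g‖⁻¹ * τ, by positivity,
    mul_le_one₀ (inv_le_one_of_one_le₀ hN) hτ0 hτ1, ?_⟩
  · rw [stepv, norm_smul, norm_inv, norm_norm, inv_mul_cancel₀ hN0]
  · rw [stepv]
    generalize ‖v - a • g‖⁻¹ = r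
    rw [hvw]
    module

theorem continuousAt_stepv {X : Type*} [NormedAddCommGroup X] [InnerProductSpace ℝ X]
    {v g : X} {a : ℝ} (h : v - a • g ≠ 0) : ContinuousAt (stepv v g) a := by
  have hc : ContinuousAt (fun a : ℝ => v - a • g) a := by fun_prop
  exact (hc.norm.inv₀ (norm_ne_zero_iff.2 h)).smul hc

/-- Armijo-type decrease of `E ∘ p` along the normalized gradient step. -/
theorem eventually_peakSelection_stepv_le
    {X : Type*} [NormedAddCommGroup X] [InnerProductSpace ℝ X] [CompleteSpace X]
    {E : X → ℝ} (hE : ContDiff ℝ 1 E) {L : Submodule ℝ X} {v0L : X}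
    (hv0L : v0L ∈ L) (hv0L1 : ‖v0L‖ < 1) {v : X} (hv : v ∈ V0 L v0L) {p : X → X}
    (hpsel : ∀ u : X, ‖u‖ = 1 →
      p u ∈ halfspaceCone L u ∧ IsLocalMaxOn E (halfspaceCone L u) (p u))
    {t : ℝ} {wL : X} (hpv : p v = t • v + wL) (hwL : wL ∈ L) (ht : 0 < t)
    (hpc : ContinuousOn p (V0 L v0L)) (hg : gradient E (p v) ≠ 0)
    {σ : ℝ} (hσ : σ ∈ Ioo (0 : ℝ) 1) :
    ∀ᶠ a in 𝓝[>] (0 : ℝ), E (p (stepv v (gradient E (p v)) a)) ≤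
      E (p v) - σ * a * t * ‖gradient E (p v)‖ ^ 2 := by
  obtain ⟨hσ0, hσ1⟩ := hσ
  obtain ⟨hv1, w, hw, τ, hτ0, hτ1, hvw⟩ := id hv
  have hdiff : DifferentiableAt ℝ E (p v) := hE.differentiable one_ne_zero _
  have hmax := (hpsel v hv1).2
  have horth := fun (c : ℝ) (l : X) (hl : l ∈ L) =>
    inner_gradient_eq_zero_of_isLocalMaxOn_halfspaceCone hdiff hpv ht hwL hmax c hl
  have hgrad : ∀ h, fderiv ℝ E (p v) h = inner ℝ (gradient E (p v)) h := fun h => by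
    rw [inner_gradient_left]
  set g := gradient E (p v) with hgdef
  have hvg : inner ℝ g v = 0 := by simpa using horth 1 0 L.zero_mem
  have hgL : g ∈ Lᗮ := (Submodule.mem_orthogonal' L g).2 fun l hl => by simpa using horth 0 l hl
  have hLw : ∀ l ∈ L, inner ℝ l w = 0 := fun l hl => Submodule.inner_right_of_mem_orthogonal hl hw
  have hgw : inner ℝ g w = 0 := by
    have := horth 1 (-(τ • v0L)) (L.neg_mem (L.smul_mem _ hv0L))
    rwa [one_smul, ← sub_eq_add_neg, sub_eq_of_eq_add hvw] at this
  have hw0 : w ≠ 0 := by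
    rintro rfl
    rw [hvw, zero_add, norm_smul, Real.norm_of_nonneg hτ0] at hv1
    nlinarith [norm_nonneg v0L]
  have hww : 0 < ‖w‖ ^ 2 := by positivity
  have hvwi : inner ℝ v w = ‖w‖ ^ 2 := by
    rw [hvw, inner_add_left, real_inner_self_eq_norm_sq, hLw _ (L.smul_mem _ hv0L), add_zero]
  -- the `v`-coefficient of `p (stepv v g a)`
  let s : ℝ → ℝ := fun a => inner ℝ (p (stepv v g a)) w / ‖w‖ ^ 2
  have hstep0 : stepv v g 0 = v := by simp [stepv, hv1]
  have hmem : ∀ a, stepv v g a ∈ V0 L v0L := stepv_mem_V0 hv hgL hvg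
  have hstep : Tendsto (stepv v g) (𝓝[>] 0) (𝓝[V0 L v0L] v) := by
    refine tendsto_nhdsWithin_iff.2 ⟨?_, Eventually.of_forall hmem⟩
    have hne : v - (0 : ℝ) • g ≠ 0 := by
      rw [zero_smul, sub_zero, ← norm_ne_zero_iff, hv1]
      exact one_ne_zero
    have := (continuousAt_stepv hne).tendsto
    rw [hstep0] at this
    exact this.mono_left nhdsWithin_le_nhds
  have hp : Tendsto (fun a => p (stepv v g a)) (𝓝[>] 0) (𝓝 (p v)) := (hpc v hv).tendsto.comp hstep
  have hs : Tendsto s (𝓝[>] 0) (𝓝 t) := by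
    have h : Tendsto s (𝓝[>] 0) (𝓝 (inner ℝ (p v) w / ‖w‖ ^ 2)) :=
      (hp.inner tendsto_const_nhds).div_const _
    rwa [hpv, inner_add_left, real_inner_smul_left, hvwi, hLw _ hwL, add_zero,
      mul_div_cancel_right₀ _ hww.ne'] at h
  have ha : Tendsto (fun a : ℝ => a) (𝓝[>] 0) (𝓝 0) := tendsto_id.mono_left nhdsWithin_le_nhds
  let q : ℝ → X := fun a => p (stepv v g a) + (s a * a) • g
  have hq : Tendsto q (𝓝[>] 0) (𝓝 (p v)) := by
    simpa using hp.add ((hs.mul ha).smul_const g)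
  have hqcone : ∀ a, q a ∈ halfspaceCone L v := by
    intro a
    obtain ⟨t', ht', l, hl, hpl⟩ := (hpsel _ (hmem a).1).1
    have hsa : s a = t' * ‖v - a • g‖⁻¹ := by
      have hi : inner ℝ (p (stepv v g a)) w = t' * ‖v - a • g‖⁻¹ * ‖w‖ ^ 2 := by
        rw [hpl, stepv, inner_add_left, hLw l hl, real_inner_smul_left, real_inner_smul_left,
          inner_sub_left, real_inner_smul_left, hgw, hvwi]
        ring
      simp only [s, hi]
      exact mul_div_cancel_right₀ _ hww.ne'
    refine ⟨s a, by rw [hsa]; positivity, l, hl, ?_⟩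
    simp only [q]
    rw [hsa, hpl, stepv]
    module
  have hqle : ∀ᶠ a in 𝓝[>] (0 : ℝ), E (q a) ≤ E (p v) :=
    (tendsto_nhdsWithin_iff.2 ⟨hq, Eventually.of_forall hqcone⟩).eventually hmax
  have hgpos : 0 < ‖g‖ := norm_pos_iff.2 hg
  have hstrict := (hE.contDiffAt (x := p v)).hasStrictFDerivAt one_ne_zero
  have hbound := (hp.prodMk_nhds hq).eventually
    (hstrict.isLittleO.def (show 0 < (1 - σ) / 2 * ‖g‖ by nlinarith))
  have hst : 2 * σ / (1 + σ) * t < t := by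
    have : 2 * σ / (1 + σ) < 1 := by rw [div_lt_one (by linarith)]; linarith
    nlinarith
  filter_upwards [hqle, hbound, hs.eventually_const_lt hst, self_mem_nhdsWithin]
    with a hqa hba hsa (ha0 : 0 < a)
  have hs0 : 0 < s a := lt_of_le_of_lt (by positivity) hsa
  have hsub : p (stepv v g a) - q a = -((s a * a) • g) := by simp [q]
  simp only [hsub] at hba
  rw [hgrad, inner_neg_right, real_inner_smul_right, real_inner_self_eq_norm_sq, norm_neg,
    norm_smul, Real.norm_of_nonneg (by positivity : 0 ≤ s a * a)] at hba
  have hle := (le_abs_self _).trans hba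
  have hcoef : σ * t ≤ s a * ((1 + σ) / 2) := by
    have : 2 * σ / (1 + σ) * t * ((1 + σ) / 2) = σ * t := by field_simp
    nlinarith
  have := mul_le_mul_of_nonneg_right hcoef (by positivity : 0 ≤ a * ‖g‖ ^ 2)
  linarith

/-- Theorem 3.8, feasibility of the normalized GLL-type nonmonotone
step-size search: under continuity of the peak selection on `V₀`, `t_k > 0` and
`g_k ≠ 0`, the GLL condition
`E(p(v_k(α))) ≤ max_{1 ≤ j ≤ min{M,k+1}} E(p(v_{k+1−j})) − σ α t_k ‖g_k‖²`
holds for all sufficiently small `α > 0`.  (Here the maximum over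
`j = 1, …, min{M, k+1}` of `E(p(v_{k+1−j}))` is written as the maximum over
`i = 0, …, min{M, k+1} − 1` of `E(p(v_{k−i}))`.) -/
theorem statement16
    {X : Type*} [NormedAddCommGroup X] [InnerProductSpace ℝ X] [CompleteSpace X]
    (E : X → ℝ) (hE : ContDiff ℝ 1 E)
    (L : Submodule ℝ X) [FiniteDimensional ℝ L]
    (v0perp v0L : X) (hv0perp : v0perp ∈ Lᗮ) (hv0perp0 : v0perp ≠ 0) (hv0L : v0L ∈ L)
    (hv0norm : ‖v0perp + v0L‖ = 1)
    (k : ℕ) (v : ℕ → X) (hV0 : ∀ j ≤ k, v j ∈ V0 L v0L)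
    (p : X → X)
    (hpsel : ∀ u : X, ‖u‖ = 1 →
      p u ∈ halfspaceCone L u ∧ IsLocalMaxOn E (halfspaceCone L u) (p u))
    (t : ℕ → ℝ) (wLs : ℕ → X)
    (hdecomp : ∀ j ≤ k, p (v j) = t j • v j + wLs j ∧ 0 ≤ t j ∧ wLs j ∈ L)
    (hpc : ContinuousOn p (V0 L v0L))
    (htk : 0 < t k)
    (hgk : gradient E (p (v k)) ≠ 0)
    (M : ℕ) (hM : 1 ≤ M)
    (σ : ℝ) (hσ : σ ∈ Set.Ioo (0 : ℝ) 1) :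
    ∃ αA > 0, ∀ a : ℝ, 0 < a → a < αA →
      E (p (stepv (v k) (gradient E (p (v k))) a)) ≤
        (Finset.range (min M (k + 1))).sup'
            (Finset.nonempty_range_iff.mpr (by omega)) (fun i => E (p (v (k - i))))
          - σ * a * t k * ‖gradient E (p (v k))‖ ^ 2 := by
  have hnorm : ‖v0L‖ < 1 := by
    have h : ‖v0perp + v0L‖ ^ 2 = ‖v0perp‖ ^ 2 + ‖v0L‖ ^ 2 := by
      rw [norm_add_sq_real, Submodule.inner_left_of_mem_orthogonal hv0L hv0perp]
      ring
    have : 0 < ‖v0perp‖ := norm_pos_iff.2 hv0perp0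
    rw [hv0norm] at h
    nlinarith [norm_nonneg v0L]
  obtain ⟨hpk, -, hwk⟩ := hdecomp k le_rfl
  obtain ⟨αA, hαA, hdec⟩ := mem_nhdsGT_iff_exists_Ioo_subset.1
    (eventually_peakSelection_stepv_le hE hv0L hnorm (hV0 k le_rfl) hpsel hpk hwk htk hpc hgk hσ)
  refine ⟨αA, hαA, fun a ha0 ha => (hdec ⟨ha0, ha⟩).trans ?_⟩
  gcongr
  exact Finset.le_sup' (fun i => E (p (v (k - i)))) (Finset.mem_range.2 (by omega : 0 < min M (k + 1)))
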